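/- arXiv:2202.03400 — 2 statements merged into one kernel-verified Lean document; each statement's English description precedes it below -/
import Mathlib

section
/- Let N, r, K be integers with N ≥ 1 and 1 ≤ K ≤ r - 4. Then (1/2)·((r - 1)/(N·K)) + (1/2)·((r + 1)/(N·K)) = r/(N·K), and (1/2)·(4r - 4)/(r - K - 2) + (1/2)·4(r + 1)/(r - K) < (4r - 2)/(r - K - 2), where all quantities are interpreted as real numbers. -/
theorem time_sharing_beats_odd_case (N r K : ℤ) (hN : 1 ≤ N) (hK : 1 ≤ K)
    (hr : K ≤ r - 4) :
    (1 / 2 : ℝ) * (((r : ℝ) - 1) / ((N : ℝ) * K)) +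
        (1 / 2 : ℝ) * (((r : ℝ) + 1) / ((N : ℝ) * K)) = (r : ℝ) / ((N : ℝ) * K) ∧
      (1 / 2 : ℝ) * ((4 * (r : ℝ) - 4) / ((r : ℝ) - K - 2)) +
          (1 / 2 : ℝ) * (4 * ((r : ℝ) + 1) / ((r : ℝ) - K)) <
        (4 * (r : ℝ) - 2) / ((r : ℝ) - K - 2) := by
  have hK' : (1 : ℝ) ≤ K := by exact_mod_cast hK
  have hr' : (K : ℝ) ≤ r - 4 := by exact_mod_cast hr
  have hd₀ : (0 : ℝ) < r - K := by linarith
  have hd₂ : (0 : ℝ) < r - K - 2 := by linarith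
  refine ⟨by ring, ?_⟩
  have key : (2 * (r : ℝ) + 2) / (r - K) < 2 * r / (r - K - 2) := by
    rw [div_lt_div_iff₀ hd₀ hd₂]
    linarith
  calc _ = (2 * (r : ℝ) - 2) / (r - K - 2) + (2 * r + 2) / (r - K) := by ring
    _ < (2 * (r : ℝ) - 2) / (r - K - 2) + 2 * r / (r - K - 2) := by gcongr
    _ = _ := by ring
end

section
/- Let F be a field, let y, d, r be natural numbers with r ≥ y + d + 1, let f : Fin y → F be injective, let α : Fin r → F be injective with α n ∉ range f for all n, let w : Fin y → F, and let p be a polynomial over F of degree at most d. If ∑_{i} w i / (f i - α n) + p.eval (α n) = 0 for every n : Fin r, then w i = 0 for all i and p = 0. -/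
section PartialFractions

open Polynomial

variable {F ι : Type*} [Field F]

theorem natDegree_prod_C_sub_X_le (s : Finset ι) (f : ι → F) :
    (∏ j ∈ s, (C (f j) - X)).natDegree ≤ s.card := by
  refine (natDegree_prod_le s _).trans ?_
  refine (Finset.sum_le_card_nsmul s _ 1 fun j _ => ?_).trans (by simp)
  exact (natDegree_sub_le _ _).trans (by simp)

variable [Fintype ι] [DecidableEq ι]

/-- The polynomial obtained from `∑ i, w i / (f i - X) + p` by multiplying with
`∏ j, (f j - X)`. -/
noncomputable def clearedNumerator (f w : ι → F) (p : F[X]) : F[X] :=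
  (∑ i, C (w i) * ∏ j ∈ Finset.univ.erase i, (C (f j) - X)) + p * ∏ j, (C (f j) - X)

theorem natDegree_clearedNumerator_le (f w : ι → F) (p : F[X]) :
    (clearedNumerator f w p).natDegree ≤ Fintype.card ι + p.natDegree := by
  refine natDegree_add_le_of_degree_le (natDegree_sum_le_of_forall_le _ _ fun i _ => ?_) ?_
  · refine (natDegree_C_mul_le _ _).trans ((natDegree_prod_C_sub_X_le _ f).trans ?_)
    exact (Finset.card_le_univ _).trans (Nat.le_add_right _ _)
  · have h := natDegree_prod_C_sub_X_le Finset.univ f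
    rw [Finset.card_univ] at h
    exact natDegree_mul_le.trans (by lia)

theorem eval_clearedNumerator_of_notMem_range (f w : ι → F) (p : F[X]) {x : F}
    (hx : x ∉ Set.range f) :
    (clearedNumerator f w p).eval x =
      (∏ j, (f j - x)) * ((∑ i, w i / (f i - x)) + p.eval x) := by
  simp only [clearedNumerator, eval_add, eval_finsetSum, eval_mul, eval_C, eval_prod, eval_sub,
    eval_X, mul_add, Finset.mul_sum]
  congr 1
  · refine Finset.sum_congr rfl fun i _ => ?_
    have hi : f i - x ≠ 0 := sub_ne_zero.2 fun h => hx ⟨i, h⟩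
    rw [← Finset.mul_prod_erase _ _ (Finset.mem_univ i)]
    field_simp
  · exact mul_comm _ _

theorem eval_clearedNumerator_pole (f w : ι → F) (p : F[X]) (i : ι) :
    (clearedNumerator f w p).eval (f i) = w i * ∏ j ∈ Finset.univ.erase i, (f j - f i) := by
  simp only [clearedNumerator, eval_add, eval_finsetSum, eval_mul, eval_C, eval_prod, eval_sub,
    eval_X]
  rw [Finset.prod_eq_zero (Finset.mem_univ i) (sub_self _), mul_zero, add_zero]
  refine Finset.sum_eq_single i (fun k _ hk => ?_) (by simp)
  rw [Finset.prod_eq_zero (Finset.mem_erase.2 ⟨hk.symm, Finset.mem_univ i⟩) (sub_self _), mul_zero]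

theorem eq_zero_of_clearedNumerator_eq_zero {f w : ι → F} (hf : Function.Injective f) {p : F[X]}
    (h : clearedNumerator f w p = 0) : (∀ i, w i = 0) ∧ p = 0 := by
  have hw : ∀ i, w i = 0 := fun i => by
    have hi := eval_clearedNumerator_pole f w p i
    rw [h, eval_zero, eq_comm, mul_eq_zero] at hi
    refine hi.resolve_right (Finset.prod_ne_zero_iff.2 fun j hj => ?_)
    exact sub_ne_zero.2 (hf.ne (Finset.ne_of_mem_erase hj))
  refine ⟨hw, ?_⟩
  simp only [clearedNumerator, hw, C_0, zero_mul, Finset.sum_const_zero, zero_add,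
    mul_eq_zero] at h
  refine h.resolve_right (Finset.prod_ne_zero_iff.2 fun j _ => ?_)
  rw [← neg_sub]
  exact neg_ne_zero.2 (X_sub_C_ne_zero _)

end PartialFractions

theorem answers_decodable {F : Type*} [Field F] (y d r : ℕ) (hr : y + d + 1 ≤ r)
    (f : Fin y → F) (hf : Function.Injective f)
    (α : Fin r → F) (hα : Function.Injective α)
    (hαf : ∀ n : Fin r, α n ∉ Set.range f)
    (w : Fin y → F) (p : Polynomial F) (hp : p.natDegree ≤ d)
    (hzero : ∀ n : Fin r, (∑ i, w i / (f i - α n)) + p.eval (α n) = 0) :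
    (∀ i, w i = 0) ∧ p = 0 := by
  apply eq_zero_of_clearedNumerator_eq_zero hf
  apply Polynomial.eq_zero_of_natDegree_lt_card_of_eval_eq_zero _ hα
  · intro n
    rw [eval_clearedNumerator_of_notMem_range f w p (hαf n), hzero n, mul_zero]
  · have h := natDegree_clearedNumerator_le f w p
    rw [Fintype.card_fin] at h ⊢
    lia
end
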